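/- Let f: {±1}ⁿ → {±1} be a linear threshold function and σ, ρ ∈ [0,1]. Then E_{z ~ N_σ}[|T_{1−ρ}f(z) − f(z)|] ≤ (5/2)·√ρ, where N_σ is the σ-biased product distribution and T_{1−ρ} is the noise operator with respect to N_σ. -/

import Mathlib

open MeasureTheory Real

/-- The point which agrees with `u` on the coordinates selected by `J` and with `z` elsewhere. -/
def mix {ι : Type*} (J : ι → Bool) (u z : ι → Bool) : ι → Bool :=
  fun i => if J i then u i else z i

/-- The `±1` value encoded by a bit. -/
def bitSign (b : Bool) : ℝ := if b then 1 else -1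

/-- Flip the `j`-th bit of `r`. -/
def flipBit {ι : Type*} [DecidableEq ι] (j : ι) (r : ι → Bool) : ι → Bool :=
  Function.update r j (!r j)

lemma bitSign_not (b : Bool) : bitSign (!b) = -bitSign b := by
  cases b <;> simp [bitSign]

lemma bitSign_mul_self (b : Bool) : bitSign b * bitSign b = 1 := by
  cases b <;> simp [bitSign]

section Flip

variable {ι : Type*} [DecidableEq ι]

lemma flipBit_flipBit (j : ι) (r : ι → Bool) : flipBit j (flipBit j r) = r := by
  simp [flipBit]

lemma flipBit_same (j : ι) (r : ι → Bool) : flipBit j r j = !r j := by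
  simp [flipBit]

lemma flipBit_of_ne {j k : ι} (h : k ≠ j) (r : ι → Bool) : flipBit j r k = r k := by
  simp [flipBit, h]

variable [Fintype ι]

lemma sum_flipBit (j : ι) (g : (ι → Bool) → ℝ) : ∑ r, g (flipBit j r) = ∑ r, g r :=
  Function.Bijective.sum_comp (Function.Involutive.bijective (flipBit_flipBit j)) g

lemma sum_bitSign_mul_bitSign (j k : ι) :
    ∑ r : ι → Bool, bitSign (r j) * bitSign (r k) =
      if j = k then (2 : ℝ) ^ Fintype.card ι else 0 := by
  split_ifs with h
  · subst h
    simp [bitSign_mul_self]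
  · have h1 := sum_flipBit j fun r => bitSign (r j) * bitSign (r k)
    simp only [flipBit_same, flipBit_of_ne (Ne.symm h), bitSign_not, neg_mul,
      Finset.sum_neg_distrib] at h1
    linarith

lemma sum_sq_sum_bitSign (s : ι → ℝ) (hs : ∀ j, s j * s j = 1) :
    ∑ r : ι → Bool, (∑ j, s j * bitSign (r j)) ^ 2 =
      2 ^ Fintype.card ι * (Fintype.card ι : ℝ) := by
  calc ∑ r : ι → Bool, (∑ j, s j * bitSign (r j)) ^ 2
      = ∑ r : ι → Bool, ∑ j, ∑ k, s j * s k * (bitSign (r j) * bitSign (r k)) := by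
        refine Finset.sum_congr rfl fun r _ => ?_
        rw [sq, Finset.sum_mul_sum]
        refine Finset.sum_congr rfl fun j _ => Finset.sum_congr rfl fun k _ => ?_
        ring
    _ = ∑ j, ∑ k, s j * s k * ∑ r : ι → Bool, bitSign (r j) * bitSign (r k) := by
        rw [Finset.sum_comm]
        refine Finset.sum_congr rfl fun j _ => ?_
        rw [Finset.sum_comm]
        simp only [Finset.mul_sum]
    _ = 2 ^ Fintype.card ι * (Fintype.card ι : ℝ) := by
        simp only [sum_bitSign_mul_bitSign, mul_ite, mul_zero, Finset.sum_ite_eq,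
          Finset.mem_univ, if_true, hs]
        simp [mul_comm]

/-- The total influence of a bounded unate function of `m` uniform bits is `O(√m)`. -/
lemma sum_abs_sub_flipBit_le (F : (ι → Bool) → ℝ) (hF : ∀ r, |F r| ≤ 1) (s : ι → ℝ)
    (hs : ∀ j, s j * s j = 1)
    (hu : ∀ j r, |F r - F (flipBit j r)| = s j * bitSign (r j) * (F r - F (flipBit j r))) :
    ∑ r, ∑ j, |F r - F (flipBit j r)| ≤
      2 * (2 ^ Fintype.card ι * √(Fintype.card ι : ℝ)) := by
  have key : ∀ j, ∑ r, |F r - F (flipBit j r)| = 2 * ∑ r, s j * bitSign (r j) * F r := by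
    intro j
    have h1 := sum_flipBit j fun r => s j * bitSign (r j) * F r
    simp only [flipBit_same, bitSign_not, mul_neg, neg_mul, Finset.sum_neg_distrib] at h1
    simp only [hu, mul_sub, Finset.sum_sub_distrib]
    linarith
  rw [Finset.sum_comm]
  simp only [key, ← Finset.mul_sum]
  rw [Finset.sum_comm]
  refine mul_le_mul_of_nonneg_left ?_ (by norm_num)
  calc ∑ r, ∑ j, s j * bitSign (r j) * F r
      ≤ ∑ r : ι → Bool, |∑ j, s j * bitSign (r j)| := by
        refine Finset.sum_le_sum fun r _ => ?_
        rw [← Finset.sum_mul]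
        refine (le_abs_self _).trans ?_
        rw [abs_mul]
        exact mul_le_of_le_one_right (abs_nonneg _) (hF r)
    _ ≤ 2 ^ Fintype.card ι * √(Fintype.card ι : ℝ) := by
        refine abs_le_of_sq_le_sq' ?_ (by positivity) |>.2
        refine (sq_sum_le_card_mul_sum_sq).trans ?_
        simp only [sq_abs, sum_sq_sum_bitSign s hs]
        rw [mul_pow, Real.sq_sqrt (Nat.cast_nonneg _)]
        simp [sq, mul_assoc]

end Flip

section Mix

variable {ι : Type*} [Fintype ι] (β : Measure Bool) [IsProbabilityMeasure β]

/-- Exchanging two independent samples on a set of coordinates preserves their joint law. -/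
lemma measurePreserving_mix_prod (J : ι → Bool) :
    MeasurePreserving (fun p : (ι → Bool) × (ι → Bool) => (mix J p.2 p.1, mix J p.1 p.2))
      ((Measure.pi fun _ => β).prod (Measure.pi fun _ => β))
      ((Measure.pi fun _ => β).prod (Measure.pi fun _ => β)) := by
  classical
  refine ⟨measurable_of_finite _, ?_⟩
  refine Measure.ext_of_singleton fun p => ?_
  have hpre : (fun p : (ι → Bool) × (ι → Bool) => (mix J p.2 p.1, mix J p.1 p.2)) ⁻¹' {p} =
      {(mix J p.2 p.1, mix J p.1 p.2)} := by
    ext q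
    simp only [Set.mem_preimage, Set.mem_singleton_iff, Prod.ext_iff, funext_iff, mix]
    constructor
    · rintro ⟨h1, h2⟩
      constructor <;> intro i <;> have := h1 i <;> have := h2 i <;> cases hJ : J i <;> simp_all
    · rintro ⟨h1, h2⟩
      constructor <;> intro i <;> have := h1 i <;> have := h2 i <;> cases hJ : J i <;> simp_all
  have hs : ∀ a b : ι → Bool,
      ((Measure.pi fun _ => β).prod (Measure.pi fun _ => β)) {(a, b)} =
        ∏ i, β {a i} * β {b i} := by
    intro a b
    rw [← Set.singleton_prod_singleton, Measure.prod_prod, Measure.pi_singleton,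
      Measure.pi_singleton, Finset.prod_mul_distrib]
  rw [Measure.map_apply (measurable_of_finite _) (MeasurableSet.singleton _), hpre, hs]
  rw [show p = (p.1, p.2) from rfl, hs]
  refine Finset.prod_congr rfl fun i _ => ?_
  cases hJ : J i <;> simp [mix, hJ, mul_comm]

lemma measurePreserving_mix (J : ι → Bool) :
    MeasurePreserving (fun p : (ι → Bool) × (ι → Bool) => mix J p.2 p.1)
      ((Measure.pi fun _ => β).prod (Measure.pi fun _ => β)) (Measure.pi fun _ => β) :=
  measurePreserving_fst.comp (measurePreserving_mix_prod β J)

/-- The noise operator is positive semidefinite, conditionally on the resampled set. -/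
lemma integral_mul_mix_nonneg (f : (ι → Bool) → ℝ) (J : ι → Bool) :
    0 ≤ ∫ p, f p.1 * f (mix J p.2 p.1)
      ∂((Measure.pi fun _ : ι => β).prod (Measure.pi fun _ : ι => β)) := by
  set μ : Measure (ι → Bool) := Measure.pi fun _ => β
  have hmm : ∀ u v z : ι → Bool, mix J u (mix J v z) = mix J u z := by
    intro u v z
    funext i
    cases hJ : J i <;> simp [mix, hJ]
  have hmp : MeasurePreserving (fun p : (ι → Bool) × (ι → Bool) => mix J p.2 p.1) (μ.prod μ) μ :=
    measurePreserving_mix β J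
  have hint : ∀ G : (ι → Bool) → ℝ, ∫ z, G z ∂μ = ∫ p, G (mix J p.2 p.1) ∂(μ.prod μ) := by
    intro G
    conv_lhs => rw [← hmp.map_eq]
    exact integral_map hmp.measurable.aemeasurable (measurable_of_finite _).aestronglyMeasurable
  rw [integral_prod _ Integrable.of_finite, hint]
  simp only [hmm, integral_const_mul]
  rw [integral_prod _ Integrable.of_finite]
  simp only [integral_mul_const]
  exact integral_nonneg fun z => mul_self_nonneg _

end Mix

/-- The expectation of `|f z - f y|` for a sample `z` and a `ρ`-noisy copy `y`. -/
noncomputable def noiseSens {ι : Type*} [Fintype ι] (βσ βρ : Measure Bool) (f : (ι → Bool) → ℝ) : ℝ :=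
  ∫ J, ∫ p, |f p.1 - f (mix J p.2 p.1)|
    ∂((Measure.pi fun _ : ι => βσ).prod (Measure.pi fun _ : ι => βσ))
    ∂(Measure.pi fun _ : ι => βρ)

section Sens

variable {ι : Type*} [Fintype ι] (βσ βρ : Measure Bool) [IsProbabilityMeasure βσ]
  [IsProbabilityMeasure βρ]

lemma noiseSens_le_one (f : (ι → Bool) → ℝ) (hf : ∀ x, f x = 1 ∨ f x = -1) :
    noiseSens βσ βρ f ≤ 1 := by
  have habs : ∀ x y, |f x - f y| = 1 - f x * f y := by
    intro x y
    rcases hf x with h | h <;> rcases hf y with h' | h' <;> rw [h, h'] <;> norm_num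
  have h : ∀ J : ι → Bool, ∫ p, |f p.1 - f (mix J p.2 p.1)|
      ∂((Measure.pi fun _ : ι => βσ).prod (Measure.pi fun _ : ι => βσ)) ≤ 1 := by
    intro J
    simp only [habs]
    rw [integral_sub Integrable.of_finite Integrable.of_finite]
    have := integral_mul_mix_nonneg βσ f J
    simp only [integral_const, probReal_univ, smul_eq_mul, mul_one]
    linarith
  calc noiseSens βσ βρ f ≤ ∫ _J : ι → Bool, (1 : ℝ) ∂(Measure.pi fun _ : ι => βρ) :=
        integral_mono Integrable.of_finite Integrable.of_finite h
    _ = 1 := by simp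

lemma integral_abs_noise_sub_le (f : (ι → Bool) → ℝ) :
    ∫ z, |(∫ p : (ι → Bool) × (ι → Bool), f (mix p.1 p.2 z)
        ∂((Measure.pi fun _ : ι => βρ).prod (Measure.pi fun _ : ι => βσ))) - f z|
      ∂(Measure.pi fun _ : ι => βσ) ≤ noiseSens βσ βρ f := by
  set μ : Measure (ι → Bool) := Measure.pi fun _ => βσ
  set ν : Measure (ι → Bool) := Measure.pi fun _ => βρ
  calc ∫ z, |(∫ p : (ι → Bool) × (ι → Bool), f (mix p.1 p.2 z) ∂(ν.prod μ)) - f z| ∂μ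
      ≤ ∫ z, ∫ p : (ι → Bool) × (ι → Bool), |f z - f (mix p.1 p.2 z)| ∂(ν.prod μ) ∂μ := by
        refine integral_mono Integrable.of_finite Integrable.of_finite fun z => ?_
        have h : (∫ p : (ι → Bool) × (ι → Bool), f (mix p.1 p.2 z) ∂(ν.prod μ)) - f z =
            ∫ p : (ι → Bool) × (ι → Bool), (f (mix p.1 p.2 z) - f z) ∂(ν.prod μ) := by
          rw [integral_sub Integrable.of_finite Integrable.of_finite]
          simp
        simp only [h, abs_sub_comm (f z)]
        exact abs_integral_le_integral_abs
    _ = ∫ z, ∫ J, ∫ u, |f z - f (mix J u z)| ∂μ ∂ν ∂μ := by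
        congr 1
        funext z
        rw [integral_prod _ Integrable.of_finite]
    _ = ∫ J, ∫ z, ∫ u, |f z - f (mix J u z)| ∂μ ∂μ ∂ν :=
        integral_integral_swap Integrable.of_finite
    _ = noiseSens βσ βρ f := by
        unfold noiseSens
        congr 1
        funext J
        rw [integral_prod _ Integrable.of_finite]

end Sens

/-- The law on `Option κ` giving mass `ρ` to each `some j` and the rest to `none`. -/
noncomputable def bucketMeasure (κ : Type*) [Fintype κ] [MeasurableSpace (Option κ)] (ρ : ℝ) :
    Measure (Option κ) :=
  ENNReal.ofReal (1 - Fintype.card κ * ρ) • Measure.dirac none +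
    ∑ j : κ, ENNReal.ofReal ρ • Measure.dirac (some j)

lemma isProbabilityMeasure_bucketMeasure {κ : Type*} [Fintype κ] [MeasurableSpace (Option κ)]
    {ρ : ℝ} (h0 : 0 ≤ ρ) (h1 : Fintype.card κ * ρ ≤ 1) :
    IsProbabilityMeasure (bucketMeasure κ ρ) := by
  constructor
  simp only [bucketMeasure, Measure.coe_add, Measure.coe_smul, Pi.add_apply, Pi.smul_apply,
    measure_univ, smul_eq_mul, mul_one, Measure.coe_finsetSum, Finset.sum_apply,
    Finset.sum_const, Finset.card_univ, nsmul_eq_mul]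
  rw [← ENNReal.ofReal_natCast, ← ENNReal.ofReal_mul (Nat.cast_nonneg _),
    ← ENNReal.ofReal_add (by linarith) (by positivity)]
  simp

section Bucket

variable {κ : Type*} [Fintype κ] [DecidableEq κ]
  [MeasurableSpace (Option κ)] [DiscreteMeasurableSpace (Option κ)] {ρ : ℝ}

lemma bucketMeasure_singleton_some (j : κ) :
    bucketMeasure κ ρ {some j} = ENNReal.ofReal ρ := by
  simp [bucketMeasure, Set.indicator_apply]

lemma measurePreserving_eq_some (h0 : 0 ≤ ρ) (h1 : Fintype.card κ * ρ ≤ 1)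
    (β : Measure Bool) [IsProbabilityMeasure β] (hβ : β {true} = ENNReal.ofReal ρ) (j : κ) :
    MeasurePreserving (fun c : Option κ => decide (c = some j)) (bucketMeasure κ ρ) β := by
  have := isProbabilityMeasure_bucketMeasure h0 h1
  have hm : Measurable (fun c : Option κ => decide (c = some j)) := Measurable.of_discrete
  have hp := Measure.isProbabilityMeasure_map (μ := bucketMeasure κ ρ) hm.aemeasurable
  have htrue : (bucketMeasure κ ρ).map (fun c : Option κ => decide (c = some j)) {true} =
      β {true} := by
    rw [Measure.map_apply hm (MeasurableSet.singleton _), hβ, ← bucketMeasure_singleton_some j]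
    congr 1
    ext c
    simp
  refine ⟨hm, Measure.ext_of_singleton fun b => ?_⟩
  cases b
  · have hc : ({false} : Set Bool) = {true}ᶜ := by ext b; cases b <;> simp
    rw [hc, prob_compl_eq_one_sub (MeasurableSet.singleton _),
      prob_compl_eq_one_sub (MeasurableSet.singleton _), htrue]
  · exact htrue

end Bucket

section Halfspace

variable {ι : Type*} [Fintype ι]

/-- Extend a choice of bits on the buckets to all coordinates, with `false` on `none`. -/
def bucketBits {κ : Type*} (c : ι → Option κ) (r : κ → Bool) : ι → Bool :=
  fun i => (c i).elim false r

lemma sum_halfspace_flipBit_le {κ : Type*} [Fintype κ] [DecidableEq κ] (w : ι → ℝ) (θ : ℝ)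
    (f : (ι → Bool) → ℝ) (hf : ∀ x, f x = if 0 ≤ (∑ i, w i * bitSign (x i)) - θ then 1 else -1)
    (c : ι → Option κ) (a b : ι → Bool) :
    ∑ r : κ → Bool, ∑ j,
        |f (mix (bucketBits c r) b a) - f (mix (bucketBits c (flipBit j r)) b a)| ≤
      2 * (2 ^ Fintype.card κ * √(Fintype.card κ : ℝ)) := by
  set v : κ → ℝ := fun j =>
    ∑ i, if c i = some j then w i * (bitSign (b i) - bitSign (a i)) else 0 with hv
  have hdiff : ∀ j r,
      (∑ i, w i * bitSign (mix (bucketBits c r) b a i)) -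
        (∑ i, w i * bitSign (mix (bucketBits c (flipBit j r)) b a i)) =
      bitSign (r j) * v j := by
    intro j r
    rw [← Finset.sum_sub_distrib, hv, Finset.mul_sum]
    refine Finset.sum_congr rfl fun i _ => ?_
    rcases hc : c i with _ | k
    · simp [mix, bucketBits, hc]
    · by_cases hk : k = j
      · subst hk
        cases hr : r k <;> simp [mix, bucketBits, hc, flipBit_same, hr, show bitSign true = 1 from rfl,
          show bitSign false = -1 from rfl] <;> ring
      · simp [mix, bucketBits, hc, flipBit_of_ne hk, hk]
  refine sum_abs_sub_flipBit_le (fun r => f (mix (bucketBits c r) b a)) ?_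
    (fun j => if 0 ≤ v j then 1 else -1) ?_ ?_
  · intro r
    simp only [hf]
    split_ifs <;> norm_num
  · intro j
    split_ifs <;> norm_num
  · intro j r
    have h := hdiff j r
    simp only [hf]
    generalize (∑ i, w i * bitSign (mix (bucketBits c r) b a i)) = x at h ⊢
    generalize (∑ i, w i * bitSign (mix (bucketBits c (flipBit j r)) b a i)) = y at h ⊢
    cases hr : r j <;> simp only [hr, bitSign, if_true, Bool.false_eq_true, if_false] at h ⊢ <;>
      split_ifs <;> first | norm_num; done | (exfalso; linarith)

/-- Noise sensitivity of halfspaces, when the noise rate is at most `1 / m`. -/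
lemma noiseSens_le_of_card_mul_le (βσ βρ : Measure Bool) [IsProbabilityMeasure βσ]
    [IsProbabilityMeasure βρ] {ρ : ℝ} (h0 : 0 ≤ ρ) (hβρ : βρ {true} = ENNReal.ofReal ρ)
    (m : ℕ) (h1 : m * ρ ≤ 1) (w : ι → ℝ) (θ : ℝ) (f : (ι → Bool) → ℝ)
    (hf : ∀ x, f x = if 0 ≤ (∑ i, w i * bitSign (x i)) - θ then 1 else -1) :
    m * noiseSens βσ βρ f ≤ 2 * √m := by
  let _ : MeasurableSpace (Option (Fin m)) := ⊤
  have h1' : (Fintype.card (Fin m) : ℝ) * ρ ≤ 1 := by simpa using h1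
  have := isProbabilityMeasure_bucketMeasure (κ := Fin m) h0 h1'
  set μ : Measure (ι → Bool) := Measure.pi fun _ => βσ with hμ
  set γ : Measure (ι → Option (Fin m)) := Measure.pi fun _ => bucketMeasure (Fin m) ρ with hγ
  have heq : ∀ (r : Fin m → Bool) (j : Fin m),
      ∫ c, ∫ p, |f (mix (bucketBits c r) p.2 p.1) -
        f (mix (bucketBits c (flipBit j r)) p.2 p.1)| ∂(μ.prod μ) ∂γ = noiseSens βσ βρ f := by
    intro r j
    have hmp : MeasurePreserving (fun (c : ι → Option (Fin m)) i => decide (c i = some j)) γ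
        (Measure.pi fun _ => βρ) :=
      measurePreserving_pi _ _ fun _ => measurePreserving_eq_some h0 h1' βρ hβρ j
    unfold noiseSens
    rw [← hmp.map_eq, integral_map hmp.measurable.aemeasurable
      (measurable_of_finite _).aestronglyMeasurable]
    congr 1
    funext c
    have hsw := measurePreserving_mix_prod βσ (bucketBits c r)
    conv_rhs => rw [← hμ, ← hsw.map_eq]
    rw [integral_map hsw.measurable.aemeasurable (measurable_of_finite _).aestronglyMeasurable]
    congr 1
    funext p
    congr 3
    funext i
    rcases hc : c i with _ | k
    · simp [mix, bucketBits, hc]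
    · by_cases hk : k = j
      · subst hk
        cases hr : r k <;> simp [mix, bucketBits, hc, flipBit_same, hr]
      · simp [mix, bucketBits, hc, flipBit_of_ne hk, hk]
  have hsum : ∑ r : Fin m → Bool, ∑ j : Fin m,
      ∫ c, ∫ p, |f (mix (bucketBits c r) p.2 p.1) -
        f (mix (bucketBits c (flipBit j r)) p.2 p.1)| ∂(μ.prod μ) ∂γ ≤ 2 * (2 ^ m * √m) := by
    calc _ = ∫ c, ∫ p, ∑ r : Fin m → Bool, ∑ j : Fin m, |f (mix (bucketBits c r) p.2 p.1) -
        f (mix (bucketBits c (flipBit j r)) p.2 p.1)| ∂(μ.prod μ) ∂γ := by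
          simp only [integral_finsetSum _ fun _ _ => Integrable.of_finite]
      _ ≤ ∫ _c, ∫ _p, 2 * (2 ^ m * √(m : ℝ)) ∂(μ.prod μ) ∂γ := by
          refine integral_mono Integrable.of_finite Integrable.of_finite fun c => ?_
          refine integral_mono Integrable.of_finite Integrable.of_finite fun p => ?_
          simpa using sum_halfspace_flipBit_le w θ f hf c p.1 p.2
      _ = 2 * (2 ^ m * √m) := by simp
  simp only [heq] at hsum
  simp only [Finset.sum_const, Finset.card_univ, Fintype.card_pi, Fintype.card_bool,
    Fintype.card_fin, Finset.prod_const, nsmul_eq_mul, Nat.cast_pow, Nat.cast_ofNat] at hsum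
  have hpos : (0 : ℝ) < 2 ^ m := by positivity
  refine le_of_mul_le_mul_left ?_ hpos
  linarith

/-- Noise sensitivity of halfspaces over product measures is at most a multiple of the square root
of the noise rate. -/
lemma noiseSens_halfspace_le (βσ βρ : Measure Bool) [IsProbabilityMeasure βσ]
    [IsProbabilityMeasure βρ] {ρ : ℝ} (h0 : 0 ≤ ρ) (hβρ : βρ {true} = ENNReal.ofReal ρ)
    (w : ι → ℝ) (θ : ℝ) (f : (ι → Bool) → ℝ)
    (hf : ∀ x, f x = if 0 ≤ (∑ i, w i * bitSign (x i)) - θ then 1 else -1) :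
    noiseSens βσ βρ f ≤ 5 / 2 * √ρ := by
  have hE0 : 0 ≤ noiseSens βσ βρ f :=
    integral_nonneg fun J => integral_nonneg fun p => abs_nonneg _
  have hbound : ∀ m : ℕ, m * ρ ≤ 1 → m * noiseSens βσ βρ f ^ 2 ≤ 4 := by
    intro m hm
    have h := noiseSens_le_of_card_mul_le βσ βρ h0 hβρ m hm w θ f hf
    rcases Nat.eq_zero_or_pos m with rfl | hpos
    · simp
    · have hm0 : (0 : ℝ) < m := by exact_mod_cast hpos
      have h2 := pow_le_pow_left₀ (by positivity) h 2
      rw [mul_pow, mul_pow, Real.sq_sqrt hm0.le] at h2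
      nlinarith
  refine abs_le_of_sq_le_sq' ?_ (by positivity) |>.2
  rw [mul_pow, Real.sq_sqrt h0]
  set E := noiseSens βσ βρ f
  rcases h0.eq_or_lt with hρ | hρ
  · by_contra! hlt
    have hE2 : 0 < E ^ 2 := by
      rw [← hρ] at hlt
      simpa using hlt
    obtain ⟨m, hm⟩ := exists_nat_gt (4 / E ^ 2)
    have := hbound m (by simp [← hρ])
    rw [div_lt_iff₀ hE2] at hm
    linarith
  · rcases le_or_gt ρ (1 / 2) with hle | hgt
    · set m := ⌊1 / ρ⌋₊
      have hm1 : (m : ℝ) ≤ 1 / ρ := Nat.floor_le (by positivity)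
      have hm2 : 1 / ρ < m + 1 := Nat.lt_floor_add_one _
      have hm3 : 2 ≤ m := Nat.le_floor (by rw [le_div_iff₀ hρ]; push_cast; linarith)
      have hm4 : (2 : ℝ) ≤ m := by exact_mod_cast hm3
      rw [le_div_iff₀ hρ] at hm1
      rw [div_lt_iff₀ hρ] at hm2
      have h := hbound m hm1
      have h3 : 1 ≤ 3 / 2 * m * ρ := by nlinarith
      refine le_of_mul_le_mul_left ?_ (show (0 : ℝ) < m by linarith)
      nlinarith
    · have h := noiseSens_le_one βσ βρ f fun x => by
        rw [hf]
        split_ifs <;> simp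
      nlinarith

end Halfspace

/-- For a linear threshold function `f` on `{±1}ⁿ` (coordinates encoded by `Bool`,
`true ↦ 1`, `false ↦ -1`), with `z` drawn from the σ-biased product distribution and
`T_{1-ρ}f(z) = E_{y ~ N_{1-ρ}(z)}[f(y)]` the noise operator (each coordinate of `y`
resampled from the σ-biased bit with probability ρ), we have
`E_z |T_{1-ρ}f(z) - f(z)| ≤ (5/2)√ρ`. -/
theorem stmt_6 (n : ℕ) (σ ρ : ℝ) (hσ : σ ∈ Set.Icc (0:ℝ) 1) (hρ : ρ ∈ Set.Icc (0:ℝ) 1)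
    (w : Fin n → ℝ) (θ : ℝ) (f : (Fin n → Bool) → ℝ)
    (hf : ∀ x, f x =
      if 0 ≤ (∑ i, w i * (if x i then (1:ℝ) else -1)) - θ then 1 else -1)
    (βσ βρ : Measure Bool) [IsProbabilityMeasure βσ] [IsProbabilityMeasure βρ]
    (hβσ : βσ {false} = ENNReal.ofReal σ)   -- `false` encodes the bit `-1`
    (hβρ : βρ {true} = ENNReal.ofReal ρ)    -- `true` means "resample this coordinate"
    (μσ : Measure (Fin n → Bool)) (μρ : Measure (Fin n → Bool))
    (hμσ : μσ = Measure.pi fun _ => βσ) (hμρ : μρ = Measure.pi fun _ => βρ)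
    (T : (Fin n → Bool) → ℝ)
    (hT : ∀ z, T z =
      ∫ p : (Fin n → Bool) × (Fin n → Bool),
        f (fun i => if p.1 i then p.2 i else z i) ∂(μρ.prod μσ)) :
    (∫ z, |T z - f z| ∂μσ) ≤ 5 / 2 * Real.sqrt ρ := by
  subst hμσ hμρ
  have hT' : T = fun z => ∫ p : (Fin n → Bool) × (Fin n → Bool), f (mix p.1 p.2 z)
      ∂((Measure.pi fun _ => βρ).prod (Measure.pi fun _ => βσ)) := funext hT
  rw [hT']
  exact (integral_abs_noise_sub_le βσ βρ f).trans
    (noiseSens_halfspace_le βσ βρ hρ.1 hβρ w θ f hf)
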